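/- arXiv:2308.04293 — 2 statements merged into one kernel-verified Lean document; each statement's English description precedes it below -/
import Mathlib

section
/- Let T be the Bolyai–Rényi map, P its pressure function, and μ a T-invariant Borel probability measure on [0,1) absolutely continuous with respect to Lebesgue measure. Then for every ε > 0, |P(ε)|/ε ≤ ∫ log(2x+2) dμ(x) ≤ P(−ε)/ε; that is, the pressure values at ±ε bound the metric entropy h(μ). -/
open MeasureTheory Real Filter

/-- The Bolyai–Rényi map. -/
noncomputable def T (x : ℝ) : ℝ :=
  if x < Real.sqrt 2 - 1 then x ^ 2 + 2 * x
  else if x < Real.sqrt 3 - 1 then x ^ 2 + 2 * x - 1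
  else x ^ 2 + 2 * x - 2

/-- The transfer operator of the Bolyai–Rényi map at parameter `t`. -/
noncomputable def Lt (t : ℝ) (f : ℝ → ℝ) : ℝ → ℝ := fun x =>
  ∑ i ∈ Finset.Icc (1 : ℕ) 3,
    (2 * Real.sqrt ((i : ℝ) + x)) ^ (-(1 + t)) * f (Real.sqrt ((i : ℝ) + x) - 1)

/-- Supremum norm over the interval `[0,1]`. -/
noncomputable def supNorm (f : ℝ → ℝ) : ℝ := ⨆ x : Set.Icc (0 : ℝ) 1, |f x|

/-- The pressure function of the Bolyai–Rényi map. -/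
noncomputable def P (t : ℝ) : ℝ :=
  limsup (fun n : ℕ => (1 / n : ℝ) * Real.log (supNorm ((Lt t)^[n] (fun _ => 1)))) atTop

lemma T_maps {x : ℝ} (hx : x ∈ Set.Ico (0 : ℝ) 1) : T x ∈ Set.Ico (0 : ℝ) 1 := by
  obtain ⟨h0, h1⟩ := hx
  have s2 := Real.sq_sqrt (show (0:ℝ) ≤ 2 by norm_num)
  have s3 := Real.sq_sqrt (show (0:ℝ) ≤ 3 by norm_num)
  have p2 := Real.sqrt_nonneg 2
  have p3 := Real.sqrt_nonneg 3
  unfold T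
  split_ifs with h h'
  · constructor <;> nlinarith
  · constructor <;> nlinarith
  · constructor <;> nlinarith

lemma T_iter_maps {x : ℝ} (hx : x ∈ Set.Ico (0 : ℝ) 1) (n : ℕ) :
    T^[n] x ∈ Set.Ico (0 : ℝ) 1 := by
  induction n with
  | zero => simpa using hx
  | succ n ih => rw [Function.iterate_succ_apply']; exact T_maps ih

lemma T_measurable : Measurable T := by
  unfold T
  refine Measurable.ite measurableSet_Iio (by fun_prop) ?_
  exact Measurable.ite measurableSet_Iio (by fun_prop) (by fun_prop)

lemma Lt_measurable (t : ℝ) {f : ℝ → ℝ} (hf : Measurable f) : Measurable (Lt t f) := by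
  unfold Lt
  fun_prop

lemma Lt_iter_measurable (t : ℝ) (n : ℕ) : Measurable ((Lt t)^[n] (fun _ => 1)) := by
  induction n with
  | zero => simp
  | succ n ih => rw [Function.iterate_succ_apply']; exact Lt_measurable t ih

lemma Lt_iter_nonneg (t : ℝ) (n : ℕ) : ∀ x, 0 ≤ ((Lt t)^[n] (fun _ => 1)) x := by
  induction n with
  | zero => intro x; simp
  | succ n ih =>
    intro x
    rw [Function.iterate_succ_apply']
    unfold Lt
    exact Finset.sum_nonneg fun i _ => mul_nonneg (by positivity) (ih _)

lemma phi_lip {i x y : ℝ} (hi : 1 ≤ i) (hx : 0 ≤ x) (hy : 0 ≤ y) :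
    |(Real.sqrt (i + x) - 1) - (Real.sqrt (i + y) - 1)| ≤ |x - y| / 2 := by
  have a1 : 1 ≤ Real.sqrt (i + x) := Real.one_le_sqrt.2 (by linarith)
  have a2 : 1 ≤ Real.sqrt (i + y) := Real.one_le_sqrt.2 (by linarith)
  have e1 := Real.sq_sqrt (show 0 ≤ i + x by linarith)
  have e2 := Real.sq_sqrt (show 0 ≤ i + y by linarith)
  have : x - y = (Real.sqrt (i + x) - Real.sqrt (i + y)) * (Real.sqrt (i + x) + Real.sqrt (i + y)) := by
    nlinarith
  rw [this, abs_mul, abs_of_nonneg (show 0 ≤ Real.sqrt (i + x) + Real.sqrt (i + y) by linarith)]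
  have := abs_nonneg (Real.sqrt (i + x) - Real.sqrt (i + y))
  rw [show Real.sqrt (i + x) - 1 - (Real.sqrt (i + y) - 1) = Real.sqrt (i + x) - Real.sqrt (i + y) by ring]
  nlinarith

lemma log_lip {i x y : ℝ} (hi : 1 ≤ i) (hx : 0 ≤ x) (hy : 0 ≤ y) :
    Real.log (i + x) - Real.log (i + y) ≤ |x - y| := by
  rw [← Real.log_div (by linarith) (by linarith)]
  refine (Real.log_le_sub_one_of_pos (by apply div_pos <;> linarith)).trans ?_
  have : (i + x) / (i + y) - 1 = (x - y) / (i + y) := by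
    field_simp; ring
  rw [this, div_le_iff₀ (by linarith)]
  have h1 := le_abs_self (x - y)
  have h2 := abs_nonneg (x - y)
  nlinarith

lemma weight_dist {i x y s : ℝ} (hi : 1 ≤ i) (hx : 0 ≤ x) (hy : 0 ≤ y) :
    (2 * Real.sqrt (i + x)) ^ s ≤ Real.exp (|s| * |x - y| / 2) * (2 * Real.sqrt (i + y)) ^ s := by
  have p1 : 0 < Real.sqrt (i + x) := Real.sqrt_pos.2 (by linarith)
  have p2 : 0 < Real.sqrt (i + y) := Real.sqrt_pos.2 (by linarith)
  rw [Real.rpow_def_of_pos (by positivity), Real.rpow_def_of_pos (by positivity), ← Real.exp_add]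
  apply Real.exp_le_exp.2
  rw [Real.log_mul (by norm_num) p1.ne', Real.log_mul (by norm_num) p2.ne',
    Real.log_sqrt (by linarith), Real.log_sqrt (by linarith)]
  have h1 := log_lip hi hx hy
  have h2 := log_lip hi hy hx
  rw [abs_sub_comm y x] at h2
  have h3 : |Real.log (i + x) - Real.log (i + y)| ≤ |x - y| := abs_le.2 ⟨by linarith, h1⟩
  have h4 : (Real.log (i + x) - Real.log (i + y)) * s ≤ |x - y| * |s| := by
    refine (le_abs_self _).trans ?_
    rw [abs_mul]
    exact mul_le_mul_of_nonneg_right h3 (abs_nonneg _)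
  nlinarith

lemma phi_mem {i x : ℝ} (hi : 1 ≤ i) (hi3 : i ≤ 3) (hx : x ∈ Set.Icc (0:ℝ) 1) :
    Real.sqrt (i + x) - 1 ∈ Set.Icc (0:ℝ) 1 := by
  obtain ⟨h0, h1⟩ := hx
  have a1 : 1 ≤ Real.sqrt (i + x) := Real.one_le_sqrt.2 (by linarith)
  have a2 : Real.sqrt (i + x) ≤ 2 := Real.sqrt_le_iff.2 ⟨by norm_num, by linarith⟩
  constructor <;> linarith

lemma Lt_dist (t : ℝ) (n : ℕ) : ∀ x ∈ Set.Icc (0:ℝ) 1, ∀ y ∈ Set.Icc (0:ℝ) 1,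
    ((Lt t)^[n] (fun _ => 1)) x ≤
      Real.exp (|-(1 + t)| * |x - y|) * ((Lt t)^[n] (fun _ => 1)) y := by
  induction n with
  | zero =>
    intro x _ y _
    simp only [Function.iterate_zero, id, mul_one]
    exact Real.one_le_exp (by positivity)
  | succ n ih =>
    intro x hx y hy
    rw [Function.iterate_succ_apply']
    have hn := Lt_iter_nonneg t n
    generalize (Lt t)^[n] (fun _ => 1) = f at ih hn
    unfold Lt
    rw [Finset.mul_sum]
    apply Finset.sum_le_sum
    intro i hi
    rw [Finset.mem_Icc] at hi
    have hi1 : (1:ℝ) ≤ i := by exact_mod_cast hi.1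
    have hi3 : (i:ℝ) ≤ 3 := by exact_mod_cast hi.2
    have h1 := weight_dist (s := -(1+t)) hi1 hx.1 hy.1
    have h2 := ih _ (phi_mem hi1 hi3 hx) _ (phi_mem hi1 hi3 hy)
    have h3 : f (Real.sqrt (i + x) - 1) ≤ Real.exp (|-(1+t)| * |x - y| / 2) * f (Real.sqrt (i + y) - 1) := by
      refine h2.trans (mul_le_mul_of_nonneg_right (Real.exp_le_exp.2 ?_) (hn _))
      rw [mul_div_assoc]
      exact mul_le_mul_of_nonneg_left (phi_lip hi1 hx.1 hy.1) (abs_nonneg _)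
    calc _ ≤ (Real.exp (|-(1+t)| * |x - y| / 2) * (2 * Real.sqrt (i + y)) ^ (-(1+t))) *
          (Real.exp (|-(1+t)| * |x - y| / 2) * f (Real.sqrt (i + y) - 1)) :=
          mul_le_mul h1 h3 (hn _) (by positivity)
      _ = _ := by
        rw [show Real.exp (|-(1+t)| * |x - y|) =
          Real.exp (|-(1+t)| * |x - y| / 2) * Real.exp (|-(1+t)| * |x - y| / 2) by
            rw [← Real.exp_add]; congr 1; ring]
        ring

lemma Lt_dist' (t : ℝ) (n : ℕ) {x y : ℝ} (hx : x ∈ Set.Icc (0:ℝ) 1) (hy : y ∈ Set.Icc (0:ℝ) 1) :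
    ((Lt t)^[n] (fun _ => 1)) x ≤
      Real.exp (|-(1 + t)|) * ((Lt t)^[n] (fun _ => 1)) y := by
  refine (Lt_dist t n x hx y hy).trans
    (mul_le_mul_of_nonneg_right (Real.exp_le_exp.2 ?_) (Lt_iter_nonneg t n y))
  have : |x - y| ≤ 1 := abs_le.2 ⟨by linarith [hx.1, hy.2], by linarith [hx.2, hy.1]⟩
  nlinarith [abs_nonneg (-(1 + t))]

lemma le_supNorm (t : ℝ) (n : ℕ) {x : ℝ} (hx : x ∈ Set.Icc (0:ℝ) 1) :
    ((Lt t)^[n] (fun _ => 1)) x ≤ supNorm ((Lt t)^[n] (fun _ => 1)) := by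
  have hb : BddAbove (Set.range fun x : Set.Icc (0 : ℝ) 1 => |((Lt t)^[n] (fun _ => 1)) x|) := by
    refine ⟨Real.exp (|-(1 + t)|) * ((Lt t)^[n] (fun _ => 1)) 0, ?_⟩
    rintro _ ⟨y, rfl⟩
    simp only
    rw [abs_of_nonneg (Lt_iter_nonneg t n _)]
    exact Lt_dist' t n y.2 (by simp)
  exact (le_abs_self _).trans (le_ciSup hb ⟨x, hx⟩)

lemma supNorm_le (t : ℝ) (n : ℕ) {y : ℝ} (hy : y ∈ Set.Icc (0:ℝ) 1) :
    supNorm ((Lt t)^[n] (fun _ => 1)) ≤ Real.exp (|-(1 + t)|) * ((Lt t)^[n] (fun _ => 1)) y := by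
  have : Nonempty (Set.Icc (0:ℝ) 1) := ⟨⟨0, by simp⟩⟩
  refine ciSup_le fun x => ?_
  rw [abs_of_nonneg (Lt_iter_nonneg t n _)]
  exact Lt_dist' t n x.2 hy

/-- image of a branch -/
lemma phi_image {i : ℝ} (hi : 1 ≤ i) :
    (fun x => Real.sqrt (i + x) - 1) '' Set.Ico (0:ℝ) 1 =
      Set.Ico (Real.sqrt i - 1) (Real.sqrt (i + 1) - 1) := by
  ext y
  constructor
  · rintro ⟨x, ⟨h0, h1⟩, rfl⟩
    have := Real.sqrt_le_sqrt (show i ≤ i + x by linarith)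
    have := Real.sqrt_lt_sqrt (show 0 ≤ i + x by linarith) (show i + x < i + 1 by linarith)
    constructor <;> simp only <;> linarith
  · rintro ⟨h0, h1⟩
    have a1 : 1 ≤ Real.sqrt i := Real.one_le_sqrt.2 hi
    have e1 := Real.sq_sqrt (show 0 ≤ i by linarith)
    have e2 := Real.sq_sqrt (show 0 ≤ i + 1 by linarith)
    have a2 := Real.sqrt_nonneg (i + 1)
    refine ⟨(y + 1) ^ 2 - i, ⟨?_, ?_⟩, ?_⟩
    · nlinarith
    · nlinarith
    · simp only [add_sub_cancel]
      rw [Real.sqrt_sq (by linarith)]; ring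

lemma T_phi {i : ℕ} (hi : i ∈ Finset.Icc 1 3) {x : ℝ} (hx : x ∈ Set.Ico (0:ℝ) 1) :
    T (Real.sqrt (i + x) - 1) = x := by
  obtain ⟨h0, h1⟩ := hx
  rw [Finset.mem_Icc] at hi
  have e := Real.sq_sqrt (show 0 ≤ (i:ℝ) + x by positivity)
  unfold T
  obtain ⟨h1', h3'⟩ := hi
  interval_cases i
  · have := Real.sqrt_lt_sqrt (show 0 ≤ ((1:ℕ):ℝ) + x by positivity)
      (show ((1:ℕ):ℝ) + x < 2 by push_cast; linarith)
    rw [if_pos (by linarith)]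
    push_cast at *
    nlinarith
  · have := Real.sqrt_lt_sqrt (show 0 ≤ ((2:ℕ):ℝ) + x by positivity)
      (show ((2:ℕ):ℝ) + x < 3 by push_cast; linarith)
    have := Real.sqrt_le_sqrt (show 2 ≤ ((2:ℕ):ℝ) + x by push_cast; linarith)
    rw [if_neg (by linarith), if_pos (by linarith)]
    push_cast at *
    nlinarith
  · have := Real.sqrt_le_sqrt (show 3 ≤ ((3:ℕ):ℝ) + x by push_cast; linarith)
    have := Real.sqrt_le_sqrt (show 2 ≤ ((3:ℕ):ℝ) + x by push_cast; linarith)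
    rw [if_neg (by linarith), if_neg (by linarith)]
    push_cast at *
    nlinarith

lemma branch_int (t : ℝ) {i : ℕ} (hi : i ∈ Finset.Icc 1 3) (f : ℝ → ℝ)
    (g : ℝ → ENNReal) :
    ∫⁻ x in Set.Ico (0:ℝ) 1, ENNReal.ofReal
      ((2 * Real.sqrt ((i : ℝ) + x)) ^ (-(1 + t)) * f (Real.sqrt ((i : ℝ) + x) - 1)) * g x =
    ∫⁻ y in Set.Ico (Real.sqrt i - 1) (Real.sqrt (i + 1) - 1),
      ENNReal.ofReal (f y) * (ENNReal.ofReal (Real.exp (-t * Real.log (2 * y + 2))) * g (T y)) := by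
  have hi1 : (1:ℝ) ≤ i := by exact_mod_cast (Finset.mem_Icc.1 hi).1
  rw [← phi_image hi1]
  rw [lintegral_image_eq_lintegral_abs_deriv_mul (f' := fun x => 1 / (2 * Real.sqrt (i + x)))
    measurableSet_Ico]
  · refine setLIntegral_congr_fun measurableSet_Ico fun x hx => ?_
    have p : 0 < Real.sqrt (i + x) := Real.sqrt_pos.2 (by linarith [hx.1])
    rw [T_phi hi hx, abs_of_nonneg (by positivity),
      show 2 * (Real.sqrt (i + x) - 1) + 2 = 2 * Real.sqrt (i + x) by ring,
      ← mul_assoc, ← mul_assoc, ← ENNReal.ofReal_mul (by positivity),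
      ← ENNReal.ofReal_mul' (by positivity)]
    congr 2
    rw [Real.rpow_def_of_pos (by positivity),
      show Real.log (2 * Real.sqrt (i + x)) * -(1 + t) =
        -Real.log (2 * Real.sqrt (i + x)) + (-t * Real.log (2 * Real.sqrt (i + x))) by ring,
      Real.exp_add, Real.exp_neg, Real.exp_log (by positivity)]
    ring
  · intro x hx
    have h := ((hasDerivAt_id x).const_add (i:ℝ)).sqrt (by simp only [id]; linarith [hx.1])
    exact (h.sub_const 1).hasDerivWithinAt
  · intro x hx y hy hxy
    have : Real.sqrt (i + x) = Real.sqrt (i + y) := by simpa using hxy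
    have := (Real.sqrt_inj (by linarith [hx.1]) (by linarith [hy.1])).1 this
    linarith

lemma one_step (t : ℝ) {f : ℝ → ℝ} (hf : Measurable f) (hf0 : ∀ x, 0 ≤ f x)
    {g : ℝ → ENNReal} (hg : Measurable g) :
    ∫⁻ x in Set.Ico (0:ℝ) 1, ENNReal.ofReal (Lt t f x) * g x =
    ∫⁻ y in Set.Ico (0:ℝ) 1,
      ENNReal.ofReal (f y) * (ENNReal.ofReal (Real.exp (-t * Real.log (2 * y + 2))) * g (T y)) := by
  unfold Lt
  have : ∀ x, ENNReal.ofReal (∑ i ∈ Finset.Icc (1 : ℕ) 3,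
    (2 * Real.sqrt ((i : ℝ) + x)) ^ (-(1 + t)) * f (Real.sqrt ((i : ℝ) + x) - 1)) * g x =
    ∑ i ∈ Finset.Icc (1 : ℕ) 3, ENNReal.ofReal
    ((2 * Real.sqrt ((i : ℝ) + x)) ^ (-(1 + t)) * f (Real.sqrt ((i : ℝ) + x) - 1)) * g x := by
    intro x
    rw [ENNReal.ofReal_sum_of_nonneg fun i _ => mul_nonneg (by positivity) (hf0 _), Finset.sum_mul]
  simp_rw [this]
  rw [lintegral_finsetSum _ (fun i _ => by fun_prop)]
  rw [Finset.sum_congr rfl fun i hi => branch_int t hi f g]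
  have s4 : Real.sqrt 4 = 2 := by
    rw [show (4:ℝ) = 2 ^ 2 by norm_num, Real.sqrt_sq (by norm_num)]
  have h12 : Real.sqrt 1 ≤ Real.sqrt 2 := Real.sqrt_le_sqrt (by norm_num)
  have h23 : Real.sqrt 2 ≤ Real.sqrt 3 := Real.sqrt_le_sqrt (by norm_num)
  have h34 : Real.sqrt 3 ≤ Real.sqrt 4 := Real.sqrt_le_sqrt (by norm_num)
  rw [s4] at h34
  rw [Real.sqrt_one] at h12
  have e1 : Set.Ico (0:ℝ) 1 = Set.Ico (0:ℝ) (Real.sqrt 2 - 1) ∪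
      (Set.Ico (Real.sqrt 2 - 1) (Real.sqrt 3 - 1) ∪ Set.Ico (Real.sqrt 3 - 1) 1) := by
    rw [Set.Ico_union_Ico_eq_Ico (by linarith) (by linarith),
      Set.Ico_union_Ico_eq_Ico (by linarith) (by linarith)]
  rw [e1, lintegral_union (measurableSet_Ico.union measurableSet_Ico),
    lintegral_union measurableSet_Ico]
  · rw [show Finset.Icc 1 3 = {1, 2, 3} by rfl]
    rw [Finset.sum_insert (by simp), Finset.sum_insert (by simp), Finset.sum_singleton]
    norm_num [s4]
  · rw [Set.disjoint_left]
    rintro a ⟨_, h⟩ ⟨h', _⟩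
    linarith
  · rw [Set.disjoint_left]
    rintro a ⟨_, h⟩ (⟨h', _⟩ | ⟨h', _⟩) <;> linarith

noncomputable def birk (n : ℕ) (x : ℝ) : ℝ := ∑ k ∈ Finset.range n, Real.log (2 * T^[k] x + 2)

lemma birk_measurable (n : ℕ) : Measurable (birk n) := by
  unfold birk
  refine Finset.measurable_fun_sum _ fun k _ => ?_
  exact Real.measurable_log.comp (((T_measurable.iterate k).const_mul 2).add_const 2)

lemma duality (t : ℝ) (n : ℕ) : ∀ g : ℝ → ENNReal, Measurable g →
    ∫⁻ x in Set.Ico (0:ℝ) 1, ENNReal.ofReal (((Lt t)^[n] (fun _ => 1)) x) * g x =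
    ∫⁻ x in Set.Ico (0:ℝ) 1, ENNReal.ofReal (Real.exp (-t * birk n x)) * g (T^[n] x) := by
  induction n with
  | zero => intro g _; simp [birk]
  | succ n ih =>
    intro g hg
    rw [Function.iterate_succ_apply',
      one_step t (Lt_iter_measurable t n) (Lt_iter_nonneg t n) hg,
      ih (fun y => ENNReal.ofReal (Real.exp (-t * Real.log (2 * y + 2))) * g (T y))
        (by
          have h1 : Measurable fun y => g (T y) := hg.comp T_measurable
          exact Measurable.mul (by fun_prop) h1)]
    refine lintegral_congr fun x => ?_
    rw [← mul_assoc, ← ENNReal.ofReal_mul (by positivity), ← Real.exp_add,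
      Function.iterate_succ_apply']
    congr 3
    unfold birk
    rw [Finset.sum_range_succ]; ring_nf

lemma integral_Lt (t : ℝ) (n : ℕ) :
    ∫⁻ x in Set.Ico (0:ℝ) 1, ENNReal.ofReal (((Lt t)^[n] (fun _ => 1)) x) =
    ∫⁻ x in Set.Ico (0:ℝ) 1, ENNReal.ofReal (Real.exp (-t * birk n x)) := by
  simpa using duality t n (fun _ => 1) measurable_const

lemma log_mem {x : ℝ} (hx : x ∈ Set.Ico (0:ℝ) 1) :
    0 ≤ Real.log (2 * x + 2) ∧ Real.log (2 * x + 2) ≤ Real.log 4 :=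
  ⟨Real.log_nonneg (by linarith [hx.1]),
    Real.log_le_log (by linarith [hx.1]) (by linarith [hx.2])⟩

lemma birk_mem {x : ℝ} (hx : x ∈ Set.Ico (0:ℝ) 1) (n : ℕ) :
    0 ≤ birk n x ∧ birk n x ≤ n * Real.log 4 := by
  unfold birk
  refine ⟨Finset.sum_nonneg fun k _ => (log_mem (T_iter_maps hx k)).1, ?_⟩
  calc _ ≤ ∑ k ∈ Finset.range n, Real.log 4 :=
        Finset.sum_le_sum fun k _ => (log_mem (T_iter_maps hx k)).2
    _ = _ := by simp

/-- lower bound: the mean is at most the sup norm -/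
lemma integral_le_supNorm (t : ℝ) (n : ℕ) :
    ∫⁻ x in Set.Ico (0:ℝ) 1, ENNReal.ofReal (Real.exp (-t * birk n x)) ≤
      ENNReal.ofReal (supNorm ((Lt t)^[n] (fun _ => 1))) := by
  rw [← integral_Lt]
  calc _ ≤ ∫⁻ x in Set.Ico (0:ℝ) 1, ENNReal.ofReal (supNorm ((Lt t)^[n] (fun _ => 1))) :=
        setLIntegral_mono measurable_const fun x hx =>
          ENNReal.ofReal_le_ofReal (le_supNorm t n ⟨hx.1, hx.2.le⟩)
    _ = _ := by simp

lemma supNorm_upper (t B : ℝ) (n : ℕ)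
    (hB : ∀ x ∈ Set.Ico (0:ℝ) 1, -t * birk n x ≤ B) :
    supNorm ((Lt t)^[n] (fun _ => 1)) ≤ Real.exp (|-(1 + t)| + B) := by
  set N := supNorm ((Lt t)^[n] (fun _ => 1)) with hN
  have h1 : ENNReal.ofReal (Real.exp (-|-(1 + t)|) * N) ≤ ENNReal.ofReal (Real.exp B) := by
    calc _ = ∫⁻ x in Set.Ico (0:ℝ) 1, ENNReal.ofReal (Real.exp (-|-(1 + t)|) * N) := by simp
      _ ≤ ∫⁻ x in Set.Ico (0:ℝ) 1, ENNReal.ofReal (((Lt t)^[n] (fun _ => 1)) x) := by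
        refine setLIntegral_mono (Lt_iter_measurable t n).ennreal_ofReal fun x hx =>
          ENNReal.ofReal_le_ofReal ?_
        rw [Real.exp_neg, inv_mul_le_iff₀ (Real.exp_pos _)]
        exact supNorm_le t n ⟨hx.1, hx.2.le⟩
      _ = _ := integral_Lt t n
      _ ≤ ∫⁻ x in Set.Ico (0:ℝ) 1, ENNReal.ofReal (Real.exp B) :=
        setLIntegral_mono measurable_const fun x hx =>
          ENNReal.ofReal_le_ofReal (Real.exp_le_exp.2 (hB x hx))
      _ = _ := by simp
  rw [ENNReal.ofReal_le_ofReal_iff (Real.exp_pos _).le, Real.exp_neg,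
    inv_mul_le_iff₀ (Real.exp_pos _)] at h1
  rwa [Real.exp_add]

lemma exists_set (μ : Measure ℝ) [IsProbabilityMeasure μ]
    (hsupp : μ (Set.Ico (0 : ℝ) 1)ᶜ = 0) (hac : μ ≪ volume) (δ : ℝ) (hδ : 0 < δ) :
    ∃ (M : ℕ) (A : Set ℝ), 0 < M ∧ MeasurableSet A ∧ A ⊆ Set.Ico 0 1 ∧ μ.real Aᶜ ≤ δ ∧
      μ.restrict A ≤ (M : ENNReal) • (volume.restrict (Set.Ico (0:ℝ) 1)) := by
  set ρ := μ.rnDeriv volume with hρ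
  have mρ : Measurable ρ := Measure.measurable_rnDeriv _ _
  let A : ℕ → Set ℝ := fun M => {x | ρ x ≤ M} ∩ Set.Ico 0 1
  have mA : ∀ M, MeasurableSet (A M) := fun M =>
    (measurableSet_le mρ measurable_const).inter measurableSet_Ico
  have hanti : Antitone fun M => (A M)ᶜ := by
    intro a b hab
    apply Set.compl_subset_compl.2
    rintro x ⟨h1, h2⟩
    have h1' : ρ x ≤ (a : ENNReal) := h1
    have h3 : (a : ENNReal) ≤ b := by exact_mod_cast hab
    exact ⟨h1'.trans h3, h2⟩
  have hlim := tendsto_measure_iInter_atTop (μ := μ) (s := fun M => (A M)ᶜ)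
    (fun M => (mA M).compl.nullMeasurableSet) hanti ⟨0, measure_ne_top _ _⟩
  have hz : μ (⋂ M, (A M)ᶜ) = 0 := by
    have h1 : ∀ᵐ x ∂μ, ρ x < ⊤ := hac.ae_le (Measure.rnDeriv_lt_top μ volume)
    have h2 : ∀ᵐ x ∂μ, x ∈ Set.Ico (0:ℝ) 1 := by
      rw [ae_iff]; exact hsupp
    have h3 : ∀ᵐ x ∂μ, x ∉ (⋂ M, (A M)ᶜ) := by
      filter_upwards [h1, h2] with x hx1 hx2
      obtain ⟨M, hM⟩ := ENNReal.exists_nat_gt hx1.ne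
      simp only [Set.mem_iInter, not_forall]
      exact ⟨M, fun h => h ⟨hM.le, hx2⟩⟩
    rw [ae_iff] at h3
    simpa only [not_not, Set.ofPred_mem_eq] using h3
  rw [hz] at hlim
  have hev := (hlim.eventually (gt_mem_nhds (ENNReal.ofReal_pos.2 hδ))).and (eventually_gt_atTop 0)
  obtain ⟨M, hM, hM0⟩ := hev.exists
  refine ⟨M, A M, hM0, mA M, Set.inter_subset_right, ?_, ?_⟩
  · exact ENNReal.toReal_le_of_le_ofReal hδ.le hM.le
  · refine Measure.le_iff.2 fun s hs => ?_
    rw [Measure.restrict_apply hs, Measure.smul_apply, Measure.restrict_apply hs, smul_eq_mul,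
      ← Measure.setLIntegral_rnDeriv hac]
    calc _ ≤ ∫⁻ x in s ∩ A M, (M : ENNReal) :=
          setLIntegral_mono measurable_const fun x hx => hx.2.1
      _ = M * volume (s ∩ A M) := by simp
      _ ≤ _ := by gcongr; exact Set.inter_subset_right

lemma integral_birk (μ : Measure ℝ) [IsProbabilityMeasure μ]
    (hsupp : μ (Set.Ico (0 : ℝ) 1)ᶜ = 0)
    (hinv : ∀ A : Set ℝ, MeasurableSet A → μ (T ⁻¹' A) = μ A) (n : ℕ) :
    ∫ x, birk n x ∂μ = n * ∫ x, Real.log (2 * x + 2) ∂μ := by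
  have hmp : MeasurePreserving T μ μ := ⟨T_measurable, by
    ext s hs; rw [Measure.map_apply T_measurable hs, hinv s hs]⟩
  have h2 : ∀ᵐ x ∂μ, x ∈ Set.Ico (0:ℝ) 1 := by
    rw [ae_iff]; exact hsupp
  have ml : Measurable fun x : ℝ => Real.log (2 * x + 2) := by fun_prop
  unfold birk
  rw [integral_finsetSum]
  · rw [Finset.sum_congr rfl (g := fun _ => ∫ x, Real.log (2 * x + 2) ∂μ)]
    · simp
    · intro k _
      conv_rhs => rw [← (hmp.iterate k).map_eq]
      rw [integral_map (T_measurable.iterate k).aemeasurable ml.aestronglyMeasurable]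
  · intro k _
    refine Integrable.of_bound (C := Real.log 4)
      (ml.comp (T_measurable.iterate k)).aestronglyMeasurable ?_
    filter_upwards [h2] with x hx
    have := log_mem (T_iter_maps hx k)
    rw [Real.norm_eq_abs, abs_of_nonneg this.1]
    exact this.2

lemma main_lower (μ : Measure ℝ) [IsProbabilityMeasure μ]
    (hsupp : μ (Set.Ico (0 : ℝ) 1)ᶜ = 0)
    (hinv : ∀ A : Set ℝ, MeasurableSet A → μ (T ⁻¹' A) = μ A)
    (hac : μ ≪ volume) (t δ : ℝ) (hδ : 0 < δ) (hδ' : δ ≤ 1 / 2) :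
    ∃ M : ℝ, 0 < M ∧ ∀ n : ℕ,
      Real.exp (n * (-t * (∫ x, Real.log (2 * x + 2) ∂μ) - 4 * |t| * Real.log 4 * δ)) / M ≤
        supNorm ((Lt t)^[n] (fun _ => 1)) := by
  obtain ⟨M, A, hM, mA, hAI, hAc, hle⟩ := exists_set μ hsupp hac δ hδ
  refine ⟨2 * M, by positivity, fun n => ?_⟩
  set lam := ∫ x, Real.log (2 * x + 2) ∂μ with hlam
  set c := n * (-t * lam - 4 * |t| * Real.log 4 * δ) with hc
  have hae : ∀ᵐ x ∂μ, x ∈ Set.Ico (0:ℝ) 1 := by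
    rw [ae_iff]; exact hsupp
  have hl4 : 0 < Real.log 4 := Real.log_pos (by norm_num)
  have hlam0 : 0 ≤ lam := by
    apply integral_nonneg_of_ae
    filter_upwards [hae] with x hx using (log_mem hx).1
  have hint : ∀ n, Integrable (birk n) μ := by
    intro n
    refine Integrable.of_bound (C := n * Real.log 4) (birk_measurable n).aestronglyMeasurable ?_
    filter_upwards [hae] with x hx
    rw [Real.norm_eq_abs, abs_of_nonneg (birk_mem hx n).1]
    exact (birk_mem hx n).2
  have hlam4 : lam ≤ Real.log 4 := by
    have h1 : ∫ x, Real.log (2 * x + 2) ∂μ ≤ ∫ x, Real.log 4 ∂μ := by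
      apply integral_mono_of_nonneg
      · filter_upwards [hae] with x hx using (log_mem hx).1
      · exact integrable_const _
      · filter_upwards [hae] with x hx using (log_mem hx).2
    simpa using h1
  have hsum := integral_birk μ hsupp hinv n
  rw [← hlam, ← integral_add_compl mA (hint n)] at hsum
  have hcompl0 : 0 ≤ ∫ x in Aᶜ, birk n x ∂μ := by
    apply integral_nonneg_of_ae
    filter_upwards [ae_restrict_of_ae hae] with x hx using (birk_mem hx n).1
  have hcompl1 : ∫ x in Aᶜ, birk n x ∂μ ≤ n * Real.log 4 * δ := by
    have h1 : ∫ x in Aᶜ, birk n x ∂μ ≤ ∫ x in Aᶜ, n * Real.log 4 ∂μ := by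
      apply integral_mono_ae (hint n).integrableOn (integrable_const _)
      filter_upwards [ae_restrict_of_ae hae] with x hx using (birk_mem hx n).2
    rw [setIntegral_const, smul_eq_mul] at h1
    have : (0:ℝ) ≤ n * Real.log 4 := by positivity
    nlinarith
  have ha : μ.real A + μ.real Aᶜ = 1 := by
    rw [measureReal_add_measureReal_compl mA]; simp
  have hac0 : 0 ≤ μ.real Aᶜ := measureReal_nonneg
  -- integral of the tangent line
  have hXint : Integrable (fun x => Real.exp c * (1 + (-t * birk n x - c))) (μ.restrict A) := by
    have := (hint n).integrableOn (s := A)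
    have h2 : Integrable (fun x => birk n x) (μ.restrict A) := this
    exact ((integrable_const _).add ((h2.const_mul _).sub (integrable_const _))).const_mul _
  have hXval : ∫ x in A, Real.exp c * (1 + (-t * birk n x - c)) ∂μ =
      Real.exp c * (μ.real A + (-t * (∫ x in A, birk n x ∂μ) - μ.real A * c)) := by
    have h2 : Integrable (fun x => birk n x) (μ.restrict A) := (hint n).integrableOn (s := A)
    have h3 : Integrable (fun x => -t * birk n x - c) (μ.restrict A) :=
      (h2.const_mul _).sub (integrable_const _)
    rw [integral_const_mul, integral_add (integrable_const _) h3, integral_sub (h2.const_mul _) (integrable_const _),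
      integral_const_mul]
    simp
  have hEint : Integrable (fun x => Real.exp (-t * birk n x)) (μ.restrict A) := by
    refine Integrable.of_bound (C := Real.exp (|t| * (n * Real.log 4)))
      (((birk_measurable n).const_mul _).exp).aestronglyMeasurable ?_
    filter_upwards [ae_restrict_of_ae hae] with x hx
    rw [Real.norm_eq_abs, abs_of_nonneg (Real.exp_pos _).le]
    apply Real.exp_le_exp.2
    have := birk_mem hx n
    have h3 := neg_abs_le t
    have h4 := abs_nonneg t
    nlinarith
  have hE : Real.exp c / 2 ≤ ∫ x in A, Real.exp (-t * birk n x) ∂μ := by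
    have h1 : ∫ x in A, Real.exp c * (1 + (-t * birk n x - c)) ∂μ ≤
        ∫ x in A, Real.exp (-t * birk n x) ∂μ := by
      apply integral_mono hXint hEint
      intro x
      simp only
      have : Real.exp (-t * birk n x) = Real.exp c * Real.exp (-t * birk n x - c) := by
        rw [← Real.exp_add]; congr 1; ring
      rw [this]
      apply mul_le_mul_of_nonneg_left _ (Real.exp_pos _).le
      linarith [Real.add_one_le_exp (-t * birk n x - c)]
    refine le_trans ?_ h1
    rw [hXval, div_eq_mul_one_div]
    apply mul_le_mul_of_nonneg_left _ (Real.exp_pos _).le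
    have key : 0 ≤ -t * (∫ x in A, birk n x ∂μ) - μ.real A * c := by
      have e1 : ∫ x in A, birk n x ∂μ = n * lam - ∫ x in Aᶜ, birk n x ∂μ := by linarith
      have e2 : μ.real A = 1 - μ.real Aᶜ := by linarith
      rw [e1]
      set r := ∫ x in Aᶜ, birk n x ∂μ
      set d := μ.real Aᶜ
      have f1 : -(|t| * (n * Real.log 4 * δ)) ≤ t * r := by
        have := neg_abs_le (t * r)
        rw [abs_mul, abs_of_nonneg hcompl0] at this
        have := mul_le_mul_of_nonneg_left hcompl1 (abs_nonneg t)
        linarith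
      have f2 : -(|t| * (n * Real.log 4 * δ)) ≤ -(t * (n * (lam * d))) := by
        have g1 : t * (n * (lam * d)) ≤ |t| * (n * (lam * d)) :=
          mul_le_mul_of_nonneg_right (le_abs_self t) (by positivity)
        have g2 : lam * d ≤ Real.log 4 * δ := mul_le_mul hlam4 hAc hac0 hl4.le
        have g3 : |t| * (n * (lam * d)) ≤ |t| * (n * (Real.log 4 * δ)) := by gcongr
        linarith
      have f3 : |t| * (n * Real.log 4 * δ) * 2 ≤ μ.real A * (4 * (|t| * (n * Real.log 4 * δ))) := by
        have : 0 ≤ |t| * (n * Real.log 4 * δ) := by positivity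
        nlinarith
      have : -t * (n * lam - r) - μ.real A * c = t * r - t * (n * (lam * d)) * 1
          + μ.real A * (4 * (|t| * (n * Real.log 4 * δ))) := by
        rw [hc]
        have : d = 1 - μ.real A := by linarith
        rw [this]; ring
      rw [this]; linarith
    linarith
  -- compare with Lebesgue
  have hfin : ENNReal.ofReal (Real.exp c / 2) ≤
      ENNReal.ofReal (M * supNorm ((Lt t)^[n] (fun _ => 1))) := by
    calc _ ≤ ENNReal.ofReal (∫ x in A, Real.exp (-t * birk n x) ∂μ) := ENNReal.ofReal_le_ofReal hE
      _ = ∫⁻ x in A, ENNReal.ofReal (Real.exp (-t * birk n x)) ∂μ :=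
        ofReal_integral_eq_lintegral_ofReal hEint (ae_of_all _ fun x => (Real.exp_pos _).le)
      _ ≤ ∫⁻ x, ENNReal.ofReal (Real.exp (-t * birk n x))
          ∂((M : ENNReal) • (volume.restrict (Set.Ico (0:ℝ) 1))) := lintegral_mono' hle le_rfl
      _ = M * ∫⁻ x in Set.Ico (0:ℝ) 1, ENNReal.ofReal (Real.exp (-t * birk n x)) := by
        rw [lintegral_smul_measure, smul_eq_mul]
      _ ≤ M * ENNReal.ofReal (supNorm ((Lt t)^[n] (fun _ => 1))) := by
        gcongr; exact integral_le_supNorm t n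
      _ = _ := by
        rw [ENNReal.ofReal_mul (by positivity), ENNReal.ofReal_natCast]
  have hs0 : 0 ≤ supNorm ((Lt t)^[n] (fun _ => 1)) :=
    (Lt_iter_nonneg t n 0).trans (le_supNorm t n (by simp))
  rw [ENNReal.ofReal_le_ofReal_iff (by positivity)] at hfin
  rw [div_le_iff₀ (by positivity)]
  linarith

lemma ev_lower (μ : Measure ℝ) [IsProbabilityMeasure μ]
    (hsupp : μ (Set.Ico (0 : ℝ) 1)ᶜ = 0)
    (hinv : ∀ A : Set ℝ, MeasurableSet A → μ (T ⁻¹' A) = μ A)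
    (hac : μ ≪ volume) (t η : ℝ) (hη : 0 < η) :
    ∀ᶠ n : ℕ in atTop, -t * (∫ x, Real.log (2 * x + 2) ∂μ) - η ≤
      (1 / n : ℝ) * Real.log (supNorm ((Lt t)^[n] (fun _ => 1))) ∧
      0 < supNorm ((Lt t)^[n] (fun _ => 1)) := by
  have hl4 : 0 < Real.log 4 := Real.log_pos (by norm_num)
  set K := 4 * |t| * Real.log 4 with hK
  have hK0 : 0 ≤ K := by positivity
  set δ := min (1 / 2) (η / (2 * (K + 1))) with hδ
  have hδ0 : 0 < δ := by apply lt_min <;> positivity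
  have hKδ : K * δ ≤ η / 2 := by
    have h1 : δ ≤ η / (2 * (K + 1)) := min_le_right _ _
    rw [le_div_iff₀ (by positivity)] at h1
    nlinarith
  obtain ⟨M, hM, h⟩ := main_lower μ hsupp hinv hac t δ hδ0 (min_le_left _ _)
  have hlim : Tendsto (fun n : ℕ => Real.log M / n) atTop (nhds 0) :=
    tendsto_const_div_atTop_nhds_zero_nat _
  filter_upwards [hlim.eventually (gt_mem_nhds (half_pos hη)), eventually_gt_atTop 0] with n h1 h2
  have hn : (0:ℝ) < n := by exact_mod_cast h2
  have h3 := h n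
  have hpos : 0 < supNorm ((Lt t)^[n] (fun _ => 1)) := lt_of_lt_of_le (by positivity) h3
  refine ⟨?_, hpos⟩
  have h4 := Real.log_le_log (by positivity) h3
  rw [Real.log_div (Real.exp_pos _).ne' hM.ne', Real.log_exp] at h4
  rw [one_div, inv_mul_eq_div, le_div_iff₀ hn]
  rw [div_lt_iff₀ hn] at h1
  nlinarith

lemma ev_upper (t B : ℝ)
    (hB : ∀ n : ℕ, ∀ x ∈ Set.Ico (0:ℝ) 1, -t * birk n x ≤ n * B) (n : ℕ) (hn : 0 < n)
    (hpos : 0 < supNorm ((Lt t)^[n] (fun _ => 1))) :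
    (1 / n : ℝ) * Real.log (supNorm ((Lt t)^[n] (fun _ => 1))) ≤ |-(1 + t)| / n + B := by
  have h1 := Real.log_le_log hpos (supNorm_upper t _ n (hB n))
  rw [Real.log_exp] at h1
  have hn : (0:ℝ) < n := by exact_mod_cast hn
  rw [one_div, inv_mul_eq_div, div_le_iff₀ hn, add_mul, div_mul_cancel₀ _ hn.ne']
  linarith

lemma P_lower (μ : Measure ℝ) [IsProbabilityMeasure μ]
    (hsupp : μ (Set.Ico (0 : ℝ) 1)ᶜ = 0)
    (hinv : ∀ A : Set ℝ, MeasurableSet A → μ (T ⁻¹' A) = μ A)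
    (hac : μ ≪ volume) (t : ℝ) :
    -t * (∫ x, Real.log (2 * x + 2) ∂μ) ≤ P t := by
  apply le_of_forall_sub_le
  intro η hη
  unfold P
  have hev := ev_lower μ hsupp hinv hac t η hη
  apply le_limsup_of_frequently_le
  · exact (hev.mono fun n h => h.1).frequently
  · refine ⟨|-(1 + t)| + |t| * Real.log 4, ?_⟩
    rw [eventually_map]
    filter_upwards [hev, eventually_gt_atTop 0] with n h1 h2
    refine (ev_upper t (|t| * Real.log 4) (fun n x hx => ?_) n h2 h1.2).trans ?_
    · have := birk_mem hx n
      have h3 := neg_abs_le t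
      have h4 := abs_nonneg t
      nlinarith
    · have : |-(1 + t)| / n ≤ |-(1 + t)| :=
        div_le_self (abs_nonneg _) (by exact_mod_cast h2)
      linarith

lemma P_upper (μ : Measure ℝ) [IsProbabilityMeasure μ]
    (hsupp : μ (Set.Ico (0 : ℝ) 1)ᶜ = 0)
    (hinv : ∀ A : Set ℝ, MeasurableSet A → μ (T ⁻¹' A) = μ A)
    (hac : μ ≪ volume) (t : ℝ) (ht : 0 < t) : P t ≤ 0 := by
  apply le_of_forall_pos_le_add
  intro η hη
  unfold P
  have hev := ev_lower μ hsupp hinv hac t η hη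
  refine limsup_le_of_le ?_ ?_
  · refine IsBoundedUnder.isCoboundedUnder_le
      ⟨-t * (∫ x, Real.log (2 * x + 2) ∂μ) - η, ?_⟩
    rw [eventually_map]
    exact hev.mono fun n h => h.1
  · have hlim : Tendsto (fun n : ℕ => |-(1 + t)| / n) atTop (nhds 0) :=
      tendsto_const_div_atTop_nhds_zero_nat _
    filter_upwards [hev, eventually_gt_atTop 0, hlim.eventually (gt_mem_nhds hη)] with n h1 h2 h3
    refine (ev_upper t 0 (fun n x hx => ?_) n h2 h1.2).trans (by linarith)
    have := birk_mem hx n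
    nlinarith

theorem pressure_bounds_entropy (μ : Measure ℝ) [IsProbabilityMeasure μ]
    (hsupp : μ (Set.Ico (0 : ℝ) 1)ᶜ = 0)
    (hinv : ∀ A : Set ℝ, MeasurableSet A → μ (T ⁻¹' A) = μ A)
    (hac : μ ≪ volume) (ε : ℝ) (hε : 0 < ε) :
    |P ε| / ε ≤ (∫ x, Real.log (2 * x + 2) ∂μ) ∧
    (∫ x, Real.log (2 * x + 2) ∂μ) ≤ P (-ε) / ε := by
  have h1 := P_lower μ hsupp hinv hac ε
  have h2 := P_lower μ hsupp hinv hac (-ε)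
  have h3 := P_upper μ hsupp hinv hac ε hε
  rw [abs_of_nonpos h3, div_le_iff₀ hε, le_div_iff₀ hε]
  constructor <;> linarith
end

section
/- Let T be the Bolyai–Rényi map and E = {x ∈ [0,1) : Tⁿ(x) ∉ [√2−1, √3−1) for all integers n ≥ 0}. Let t₁ > t₀ > 0 and α, β > 0, and suppose there exist continuous functions g, f : [0,1] → ℝ, positive everywhere on [0,1], such that (M_{t₀} g)(x) ≥ e^{β} g(x) for all x ∈ [0,1] and (M_{t₁} f)(x) ≤ e^{−α} f(x) for all x ∈ [0,1]. Then t₀ < dim_H(E) < t₁. -/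
open MeasureTheory Real Filter

/-- The deleted-digit Cantor set: points whose radical expansion avoids the digit 2. -/
def E : Set ℝ :=
  {x ∈ Set.Ico (0 : ℝ) 1 |
    ∀ n : ℕ, T^[n] x ∉ Set.Ico (Real.sqrt 2 - 1) (Real.sqrt 3 - 1)}

/-- The deleted-digit transfer operator of the Bolyai–Rényi map at parameter `t`. -/
noncomputable def Mt (t : ℝ) (f : ℝ → ℝ) : ℝ → ℝ := fun x =>
  (2 * Real.sqrt (1 + x)) ^ (-t) * f (Real.sqrt (1 + x) - 1) +
  (2 * Real.sqrt (3 + x)) ^ (-t) * f (Real.sqrt (3 + x) - 1)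

namespace BR

/-- The constant of the branch. -/
noncomputable def a (b : Bool) : ℝ := if b then 3 else 1

/-- Inverse branches. -/
noncomputable def ph (b : Bool) (x : ℝ) : ℝ := Real.sqrt (a b + x) - 1

/-- Derivatives of the inverse branches. -/
noncomputable def c (b : Bool) (x : ℝ) : ℝ := (2 * Real.sqrt (a b + x))⁻¹

/-- Composition along a word, first letter outermost. -/
noncomputable def Ph : List Bool → ℝ → ℝ
  | [], x => x
  | b :: w, x => ph b (Ph w x)

/-- Derivative along a word. -/
noncomputable def D : List Bool → ℝ → ℝ
  | [], _ => 1
  | b :: w, x => c b (Ph w x) * D w x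

lemma Ph_snoc (w : List Bool) (b : Bool) (x : ℝ) : Ph (w ++ [b]) x = Ph w (ph b x) := by
  induction w with
  | nil => rfl
  | cons d w ih => simp [Ph, ih]

lemma D_snoc (w : List Bool) (b : Bool) (x : ℝ) : D (w ++ [b]) x = c b x * D w (ph b x) := by
  induction w with
  | nil => simp [D, Ph]
  | cons d w ih => simp only [List.cons_append, D, ih, Ph_snoc]; ring

lemma a_ge (b : Bool) : 1 ≤ a b := by cases b <;> simp [a]
lemma a_le (b : Bool) : a b ≤ 3 := by cases b <;> norm_num [a]

lemma sqrt_ge {b : Bool} {x : ℝ} (hx : 0 ≤ x) : 1 ≤ Real.sqrt (a b + x) := by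
  rw [Real.one_le_sqrt]; linarith [a_ge b]

lemma sqrt_le {b : Bool} {x : ℝ} (hx : x ≤ 1) : Real.sqrt (a b + x) ≤ 2 := by
  rw [Real.sqrt_le_iff]; constructor <;> linarith [a_le b]

lemma ph_mem {b : Bool} {x : ℝ} (hx : x ∈ Set.Icc (0:ℝ) 1) : ph b x ∈ Set.Icc (0:ℝ) 1 := by
  constructor <;> unfold ph <;> linarith [sqrt_ge (b := b) hx.1, sqrt_le (b := b) hx.2]

lemma ph_mono (b : Bool) : Monotone (ph b) := fun x y h => by
  unfold ph; gcongr

lemma ph_cont (b : Bool) : Continuous (ph b) := by unfold ph; fun_prop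

lemma Ph_mono (w : List Bool) : Monotone (Ph w) := by
  induction w with
  | nil => exact monotone_id
  | cons b w ih => exact (ph_mono b).comp ih

lemma Ph_mem {w : List Bool} {x : ℝ} (hx : x ∈ Set.Icc (0:ℝ) 1) : Ph w x ∈ Set.Icc (0:ℝ) 1 := by
  induction w with
  | nil => exact hx
  | cons b w ih => exact ph_mem ih

lemma c_pos {b : Bool} {x : ℝ} (hx : 0 ≤ x) : 0 < c b x := by
  have := sqrt_ge (b := b) hx
  unfold c; positivity

lemma c_le {b : Bool} {x : ℝ} (hx : 0 ≤ x) : c b x ≤ 1 / 2 := by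
  have := sqrt_ge (b := b) hx
  unfold c
  rw [one_div]
  apply inv_anti₀ <;> linarith

lemma c_ge {b : Bool} {x : ℝ} (hx : x ∈ Set.Icc (0:ℝ) 1) : 1 / 4 ≤ c b x := by
  have := sqrt_ge (b := b) hx.1
  have := sqrt_le (b := b) hx.2
  unfold c
  rw [one_div]
  apply inv_anti₀ <;> linarith

lemma c_anti {b : Bool} {x y : ℝ} (hx : 0 ≤ x) (h : x ≤ y) : c b y ≤ c b x := by
  have := sqrt_ge (b := b) hx
  unfold c
  apply inv_anti₀
  · linarith
  · gcongr

lemma zmem : (0:ℝ) ∈ Set.Icc (0:ℝ) 1 := by simp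
lemma omem : (1:ℝ) ∈ Set.Icc (0:ℝ) 1 := by simp

lemma D_pos {w : List Bool} {x : ℝ} (hx : x ∈ Set.Icc (0:ℝ) 1) : 0 < D w x := by
  induction w with
  | nil => simp [D]
  | cons b w ih => exact mul_pos (c_pos (Ph_mem hx).1) ih

lemma D_le {w : List Bool} {x : ℝ} (hx : x ∈ Set.Icc (0:ℝ) 1) : D w x ≤ (1/2) ^ w.length := by
  induction w with
  | nil => simp [D]
  | cons b w ih =>
    rw [List.length_cons, pow_succ']
    exact mul_le_mul (c_le (Ph_mem hx).1) ih (D_pos hx).le (by norm_num)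

lemma D_le_zero {w : List Bool} {x : ℝ} (hx : x ∈ Set.Icc (0:ℝ) 1) : D w x ≤ D w 0 := by
  induction w with
  | nil => simp [D]
  | cons b w ih =>
    exact mul_le_mul (c_anti (Ph_mem zmem).1 (Ph_mono w hx.1)) ih (D_pos hx).le
      (c_pos (Ph_mem zmem).1).le

lemma ph_sub {b : Bool} {u v : ℝ} (hu : 0 ≤ u) (hv : 0 ≤ v) :
    (ph b v - ph b u) * (Real.sqrt (a b + v) + Real.sqrt (a b + u)) = v - u := by
  unfold ph
  have h1 := Real.mul_self_sqrt (show 0 ≤ a b + u by linarith [a_ge b])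
  have h2 := Real.mul_self_sqrt (show 0 ≤ a b + v by linarith [a_ge b])
  linear_combination h2 - h1

lemma Ph_upper {w : List Bool} {x y : ℝ} (hx : 0 ≤ x) (h : x ≤ y) (hy : y ≤ 1) :
    Ph w y - Ph w x ≤ D w 0 * (y - x) := by
  induction w with
  | nil => simp [Ph, D]
  | cons b w ih =>
    simp only [Ph, D]
    have hu := (Ph_mem (w := w) (x := x) ⟨hx, h.trans hy⟩).1
    have huv := Ph_mono w h
    have hpu := Ph_mono w hx
    have hp := (Ph_mem (w := w) zmem).1
    set u := Ph w x
    set v := Ph w y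
    set p := Ph w 0
    have hs := ph_sub (b := b) hu (hu.trans huv)
    have hcp := sqrt_ge (b := b) hp
    have h1 : Real.sqrt (a b + p) ≤ Real.sqrt (a b + u) := by gcongr
    have h2 : Real.sqrt (a b + p) ≤ Real.sqrt (a b + v) := by gcongr; linarith
    have h3 : 0 ≤ ph b v - ph b u := sub_nonneg.2 (ph_mono b huv)
    have h4 : (ph b v - ph b u) * (2 * Real.sqrt (a b + p)) ≤ v - u := by
      rw [← hs]; gcongr; linarith
    calc ph b v - ph b u ≤ (v - u) / (2 * Real.sqrt (a b + p)) := by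
          rw [le_div_iff₀ (by linarith)]; exact h4
      _ = c b p * (v - u) := by unfold c; rw [div_eq_mul_inv, mul_comm]
      _ ≤ c b p * (D w 0 * (y - x)) := by
          gcongr
          exact (c_pos hp).le
      _ = _ := by ring

lemma Ph_lower {w : List Bool} {x y : ℝ} (hx : 0 ≤ x) (h : x ≤ y) (hy : y ≤ 1) :
    D w 0 * (y - x) ≤ Real.exp (1 - (1/2) ^ w.length) * (Ph w y - Ph w x) := by
  induction w with
  | nil => simp [Ph, D]
  | cons b w ih =>
    simp only [Ph, D]
    have hu := (Ph_mem (w := w) (x := x) ⟨hx, h.trans hy⟩).1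
    have huv := Ph_mono w h
    have hpu := Ph_mono w hx
    have hp := (Ph_mem (w := w) zmem).1
    have hvp : Ph w y - Ph w 0 ≤ (1/2) ^ w.length := by
      have h1 := Ph_upper (w := w) le_rfl (hx.trans h) hy
      have h2 := D_le (w := w) zmem
      have h3 := D_pos (w := w) zmem
      nlinarith
    set u := Ph w x
    set v := Ph w y
    set p := Ph w 0
    set q : ℝ := (1/2) ^ w.length with hq
    have hq0 : 0 < q := by positivity
    have hs := ph_sub (b := b) hu (hu.trans huv)
    have hcp := sqrt_ge (b := b) hp
    have hap := a_ge b
    have key : Real.sqrt (a b + v) ≤ Real.sqrt (a b + p) * Real.exp (q / 2) := by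
      rw [Real.exp_half, ← Real.sqrt_mul (by linarith)]
      apply Real.sqrt_le_sqrt
      have : q + 1 ≤ Real.exp q := Real.add_one_le_exp q
      nlinarith
    have h1 : Real.sqrt (a b + u) ≤ Real.sqrt (a b + v) := by gcongr
    have h3 : 0 ≤ ph b v - ph b u := sub_nonneg.2 (ph_mono b huv)
    have h4 : v - u ≤ (ph b v - ph b u) * (2 * (Real.sqrt (a b + p) * Real.exp (q / 2))) := by
      rw [← hs]; gcongr; linarith
    have h5 : c b p * (v - u) ≤ Real.exp (q / 2) * (ph b v - ph b u) := by
      calc c b p * (v - u) ≤ c b p * ((ph b v - ph b u) *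
            (2 * (Real.sqrt (a b + p) * Real.exp (q / 2)))) :=
            mul_le_mul_of_nonneg_left h4 (c_pos hp).le
        _ = Real.exp (q / 2) * (ph b v - ph b u) := by unfold c; field_simp
    have h6 : (1/2 : ℝ) ^ (b :: w).length = q / 2 := by
      rw [List.length_cons, pow_succ, ← hq]; ring
    rw [h6]
    calc c b p * D w 0 * (y - x) = c b p * (D w 0 * (y - x)) := by ring
      _ ≤ c b p * (Real.exp (1 - q) * (v - u)) := mul_le_mul_of_nonneg_left ih (c_pos hp).le
      _ = Real.exp (1 - q) * (c b p * (v - u)) := by ring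
      _ ≤ Real.exp (1 - q) * (Real.exp (q / 2) * (ph b v - ph b u)) := by gcongr
      _ = Real.exp (1 - q / 2) * (ph b v - ph b u) := by
        rw [← mul_assoc, ← Real.exp_add]; congr 2; ring

/-! The set `E`. -/

lemma T_ph {b : Bool} {y : ℝ} (hy : y ∈ Set.Ico (0:ℝ) 1) : T (ph b y) = y := by
  have hs := Real.mul_self_sqrt (show 0 ≤ a b + y by linarith [a_ge b, hy.1])
  unfold T ph
  cases b
  · have h : Real.sqrt (a false + y) < Real.sqrt 2 := by
      apply Real.sqrt_lt_sqrt <;> simp only [a] <;> norm_num <;> linarith [hy.1, hy.2]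
    rw [if_pos (by linarith)]
    simp only [a] at hs ⊢
    norm_num at hs ⊢
    linear_combination hs
  · have h : Real.sqrt 3 ≤ Real.sqrt (a true + y) := by
      apply Real.sqrt_le_sqrt; simp only [a]; norm_num; linarith [hy.1, hy.2]
    have h' : Real.sqrt 2 ≤ Real.sqrt 3 := by apply Real.sqrt_le_sqrt; norm_num
    rw [if_neg (by linarith), if_neg (by linarith)]
    simp only [a] at hs ⊢
    norm_num at hs ⊢
    linear_combination hs

lemma ph_good {b : Bool} {y : ℝ} (hy : y ∈ Set.Ico (0:ℝ) 1) :
    ph b y ∈ Set.Ico (0:ℝ) 1 ∧ ph b y ∉ Set.Ico (Real.sqrt 2 - 1) (Real.sqrt 3 - 1) := by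
  refine ⟨⟨(ph_mem ⟨hy.1, hy.2.le⟩).1, ?_⟩, ?_⟩
  · have : Real.sqrt (a b + y) < 2 := by
      rw [Real.sqrt_lt' (by norm_num)]; linarith [a_le b, hy.2]
    unfold ph; linarith
  · rintro ⟨h1, h2⟩
    unfold ph at h1 h2
    cases b
    · have h : Real.sqrt (a false + y) < Real.sqrt 2 := by
        apply Real.sqrt_lt_sqrt <;> simp only [a] <;> norm_num <;> linarith [hy.1, hy.2]
      linarith
    · have h : Real.sqrt 3 ≤ Real.sqrt (a true + y) := by
        apply Real.sqrt_le_sqrt; simp only [a]; norm_num; linarith [hy.1, hy.2]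
      linarith

lemma E_coind {S : Set ℝ} (h1 : S ⊆ Set.Ico (0:ℝ) 1)
    (h2 : ∀ x ∈ S, x ∉ Set.Ico (Real.sqrt 2 - 1) (Real.sqrt 3 - 1))
    (h3 : ∀ x ∈ S, T x ∈ S) : S ⊆ E := by
  intro x hx
  refine ⟨h1 hx, fun n => ?_⟩
  have : T^[n] x ∈ S := by
    induction n with
    | zero => exact hx
    | succ n ih => rw [Function.iterate_succ_apply']; exact h3 _ ih
  exact h2 _ this

lemma E_ph {b : Bool} {y : ℝ} (hy : y ∈ E) : ph b y ∈ E := by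
  refine ⟨(ph_good hy.1).1, fun n => ?_⟩
  cases n with
  | zero => exact (ph_good hy.1).2
  | succ n => rw [Function.iterate_succ_apply, T_ph hy.1]; exact hy.2 n

lemma zero_mem_E : (0:ℝ) ∈ E := by
  have h2 : (1:ℝ) < Real.sqrt 2 := by rw [Real.lt_sqrt] <;> norm_num
  apply E_coind (S := {0})
  · simp
  · intro x hx; rw [Set.mem_singleton_iff] at hx; subst hx
    rintro ⟨h, -⟩; linarith
  · intro x hx; rw [Set.mem_singleton_iff] at hx; subst hx
    simp only [T, Set.mem_singleton_iff]
    rw [if_pos (by linarith)]; ring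
  · rfl

lemma E_dec {x : ℝ} (hx : x ∈ E) : ∃ b, ∃ y ∈ E, x = ph b y := by
  obtain ⟨⟨h0, h1⟩, h⟩ := hx
  have hh := h 0
  simp only [Function.iterate_zero, id] at hh
  have s2 := Real.mul_self_sqrt (show (0:ℝ) ≤ 2 by norm_num)
  have s3 := Real.mul_self_sqrt (show (0:ℝ) ≤ 3 by norm_num)
  have p2 := Real.sqrt_nonneg 2
  have p3 := Real.sqrt_nonneg 3
  have hE : T x ∈ Set.Ico (0:ℝ) 1 → T x ∈ E := fun h' =>
    ⟨h', fun n => by rw [← Function.iterate_succ_apply]; exact h (n+1)⟩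
  by_cases hc : x < Real.sqrt 2 - 1
  · have hT : T x = x ^ 2 + 2 * x := by unfold T; rw [if_pos hc]
    refine ⟨false, T x, hE ?_, ?_⟩
    · rw [hT]; constructor <;> nlinarith
    · rw [hT, ph, show a false + (x ^ 2 + 2 * x) = (x+1)^2 by simp [a]; ring,
        Real.sqrt_sq (by linarith)]; ring
  · have hc' : Real.sqrt 3 - 1 ≤ x := by
      by_contra hcc
      exact hh ⟨not_lt.1 hc, not_le.1 hcc⟩
    have hT : T x = x ^ 2 + 2 * x - 2 := by unfold T; rw [if_neg hc, if_neg (not_lt.2 hc')]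
    refine ⟨true, T x, hE ?_, ?_⟩
    · rw [hT]; constructor <;> nlinarith
    · rw [hT, ph, show a true + (x ^ 2 + 2 * x - 2) = (x+1)^2 by simp [a]; ring,
        Real.sqrt_sq (by linarith)]; ring

lemma E_sub : E ⊆ Set.Icc (0:ℝ) 1 := fun _ hx => ⟨hx.1.1, hx.1.2.le⟩

lemma K_sub : closure E ⊆ Set.Icc (0:ℝ) 1 := closure_minimal E_sub isClosed_Icc

lemma K_compact : IsCompact (closure E) := isCompact_Icc.of_isClosed_subset isClosed_closure K_sub

lemma K_ph {b : Bool} {x : ℝ} (hx : x ∈ closure E) : ph b x ∈ closure E :=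
  map_mem_closure (ph_cont b) hx (fun _ h => E_ph h)

lemma K_dec {x : ℝ} (hx : x ∈ closure E) : ∃ b, ∃ y ∈ closure E, x = ph b y := by
  have hcl : IsClosed (ph false '' closure E ∪ ph true '' closure E) :=
    (K_compact.image (ph_cont _)).isClosed.union (K_compact.image (ph_cont _)).isClosed
  have : closure E ⊆ ph false '' closure E ∪ ph true '' closure E := by
    apply closure_minimal _ hcl
    intro x hx
    obtain ⟨b, y, hy, rfl⟩ := E_dec hx
    cases b
    · exact Or.inl ⟨y, subset_closure hy, rfl⟩
    · exact Or.inr ⟨y, subset_closure hy, rfl⟩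
  rcases this hx with ⟨y, hy, rfl⟩ | ⟨y, hy, rfl⟩
  · exact ⟨false, y, hy, rfl⟩
  · exact ⟨true, y, hy, rfl⟩

lemma K_diff : closure E \ Set.range (fun w => Ph w 1) ⊆ E := by
  have key : ∀ x ∈ closure E \ Set.range (fun w => Ph w 1),
      ∃ b, ∃ y ∈ closure E \ Set.range (fun w => Ph w 1), y ∈ Set.Ico (0:ℝ) 1 ∧ x = ph b y := by
    rintro x ⟨hx, hx'⟩
    obtain ⟨b, y, hy, rfl⟩ := K_dec hx
    have hyn : y ∉ Set.range (fun w => Ph w 1) := by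
      rintro ⟨w, rfl⟩
      exact hx' ⟨b :: w, rfl⟩
    refine ⟨b, y, ⟨hy, hyn⟩, ⟨(K_sub hy).1, lt_of_le_of_ne (K_sub hy).2 ?_⟩, rfl⟩
    rintro rfl
    exact hyn ⟨[], rfl⟩
  apply E_coind
  · intro x hx
    obtain ⟨b, y, -, hy, rfl⟩ := key x hx
    exact (ph_good hy).1
  · intro x hx
    obtain ⟨b, y, -, hy, rfl⟩ := key x hx
    exact (ph_good hy).2
  · intro x hx
    obtain ⟨b, y, h, hy, rfl⟩ := key x hx
    rw [T_ph hy]; exact h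

lemma dimH_K : dimH (closure E) ≤ dimH E := by
  have : closure E ⊆ E ∪ Set.range (fun w => Ph w 1) := by
    intro x hx
    by_cases h : x ∈ Set.range (fun w => Ph w 1)
    · exact Or.inr h
    · exact Or.inl (K_diff ⟨hx, h⟩)
  refine (dimH_mono this).trans ?_
  rw [dimH_union, dimH_countable (Set.countable_range _)]
  simp

/-! The operator. -/

lemma Mt_eq {s : ℝ} {h : ℝ → ℝ} {x : ℝ} :
    Mt s h x = c false x ^ s * h (ph false x) + c true x ^ s * h (ph true x) := by
  have e : ∀ b, c b x ^ s = (2 * Real.sqrt (a b + x)) ^ (-s) := by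
    intro b
    unfold c
    rw [Real.inv_rpow (by positivity), Real.rpow_neg (by positivity)]
  rw [e, e]
  simp [Mt, ph, a]

/-- Upper estimate for the Hausdorff measure. -/
lemma upper {s : ℝ} (hs : 0 < s) {f : ℝ → ℝ} (hf : ContinuousOn f (Set.Icc 0 1))
    (hfpos : ∀ x ∈ Set.Icc (0 : ℝ) 1, 0 < f x)
    (hfb : ∀ x ∈ Set.Icc (0 : ℝ) 1, Mt s f x ≤ f x) : dimH E ≤ ENNReal.ofReal s := by
  obtain ⟨x0, hx0, hmin⟩ := isCompact_Icc.exists_isMinOn ⟨0, zmem⟩ hf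
  have hm := hfpos x0 hx0
  set m := f x0
  have hS : ∀ n : ℕ, ∑ v : Fin n → Bool,
      D (List.ofFn v) 0 ^ s * f (Ph (List.ofFn v) 0) ≤ f 0 := by
    intro n
    induction n with
    | zero => simp [D, Ph]
    | succ n ih =>
      refine le_trans ?_ ih
      rw [← (Fin.consEquiv (fun _ : Fin (n+1) => Bool)).sum_comp, Fintype.sum_prod_type_right]
      apply Finset.sum_le_sum
      intro v _
      have hmem := Ph_mem (w := List.ofFn v) zmem
      have h1 := hfb _ hmem
      rw [Mt_eq] at h1
      have hD := D_pos (w := List.ofFn v) zmem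
      have e : ∀ b : Bool, List.ofFn (Fin.consEquiv (fun _ : Fin (n+1) => Bool) (b, v))
          = b :: List.ofFn v := fun b => List.ofFn_cons b v
      simp only [Fintype.sum_bool, e, D, Ph]
      rw [Real.mul_rpow (c_pos hmem.1).le hD.le, Real.mul_rpow (c_pos hmem.1).le hD.le]
      have h2 := mul_le_mul_of_nonneg_left h1 (Real.rpow_nonneg hD.le s)
      linarith
  have hcov : ∀ n : ℕ, ∀ x ∈ E, ∃ v : Fin n → Bool, ∃ y ∈ Set.Icc (0:ℝ) 1,
      x = Ph (List.ofFn v) y := by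
    intro n
    induction n with
    | zero => intro x hx; exact ⟨Fin.elim0, x, E_sub hx, by simp [Ph]⟩
    | succ n ih =>
      intro x hx
      obtain ⟨b, y, hy, rfl⟩ := E_dec hx
      obtain ⟨v, z, hz, rfl⟩ := ih y hy
      exact ⟨Fin.cons b v, z, hz, by simp [Ph]⟩
  have hdiam : ∀ n : ℕ, ∀ v : Fin n → Bool,
      Metric.ediam (Ph (List.ofFn v) '' Set.Icc 0 1) ≤ ENNReal.ofReal (D (List.ofFn v) 0) := by
    intro n v
    refine (Metric.ediam_mono (t := Set.Icc (Ph (List.ofFn v) 0) (Ph (List.ofFn v) 1)) ?_).trans ?_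
    · rintro _ ⟨y, hy, rfl⟩
      exact ⟨Ph_mono _ hy.1, Ph_mono _ hy.2⟩
    · rw [Real.ediam_Icc]
      apply ENNReal.ofReal_le_ofReal
      have := Ph_upper (w := List.ofFn v) le_rfl zero_le_one le_rfl
      linarith
  have hμ : MeasureTheory.Measure.hausdorffMeasure s E ≤ ENNReal.ofReal (f 0 / m) := by
    refine (MeasureTheory.Measure.hausdorffMeasure_le_liminf_sum (β := ℕ)
      (ι := fun n => Fin n → Bool) s E (l := atTop) (fun n => ENNReal.ofReal ((1/2)^n)) ?_
      (fun n v => Ph (List.ofFn v) '' Set.Icc 0 1) ?_ ?_).trans ?_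
    · rw [← ENNReal.ofReal_zero]
      apply ENNReal.tendsto_ofReal
      exact tendsto_pow_atTop_nhds_zero_of_lt_one (by norm_num) (by norm_num)
    · refine Eventually.of_forall fun n v => (hdiam n v).trans ?_
      apply ENNReal.ofReal_le_ofReal
      have := D_le (w := List.ofFn v) zmem
      rwa [List.length_ofFn] at this
    · refine Eventually.of_forall fun n x hx => ?_
      obtain ⟨v, y, hy, rfl⟩ := hcov n x hx
      exact Set.mem_iUnion.2 ⟨v, y, hy, rfl⟩
    · apply liminf_le_of_le
      · isBoundedDefault
      intro r hr
      obtain ⟨n, hn⟩ := hr.exists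
      refine hn.trans ?_
      calc ∑ v : Fin n → Bool, Metric.ediam (Ph (List.ofFn v) '' Set.Icc 0 1) ^ s
          ≤ ∑ v : Fin n → Bool, ENNReal.ofReal (D (List.ofFn v) 0 ^ s) := by
            apply Finset.sum_le_sum
            intro v _
            rw [← ENNReal.ofReal_rpow_of_nonneg (D_pos zmem).le hs.le]
            exact ENNReal.rpow_le_rpow (hdiam n v) hs.le
        _ = ENNReal.ofReal (∑ v : Fin n → Bool, D (List.ofFn v) 0 ^ s) := by
            rw [ENNReal.ofReal_sum_of_nonneg]
            intro v _
            exact Real.rpow_nonneg (D_pos zmem).le s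
        _ ≤ _ := by
            apply ENNReal.ofReal_le_ofReal
            rw [le_div_iff₀ hm, Finset.sum_mul]
            refine le_trans ?_ (hS n)
            apply Finset.sum_le_sum
            intro v _
            exact mul_le_mul_of_nonneg_left (hmin (Ph_mem zmem)) (Real.rpow_nonneg (D_pos zmem).le s)
  have := dimH_le_of_hausdorffMeasure_ne_top (s := E) (d := s.toNNReal)
    (by rw [Real.coe_toNNReal _ hs.le]; exact (hμ.trans_lt ENNReal.ofReal_lt_top).ne)
  exact this

/-- The transfer operator as a linear map. -/
noncomputable def Lop (s : ℝ) : Module.End ℝ (ℝ → ℝ) where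
  toFun h := Mt s h
  map_add' h k := by funext x; simp only [Mt, Pi.add_apply]; ring
  map_smul' r h := by
    funext x; simp only [Mt, Pi.smul_apply, smul_eq_mul, RingHom.id_apply]; ring

lemma Lop_apply (s : ℝ) (h : ℝ → ℝ) (x : ℝ) :
    Lop s h x = c false x ^ s * h (ph false x) + c true x ^ s * h (ph true x) := Mt_eq

lemma c_nonneg (b : Bool) (x : ℝ) : 0 ≤ c b x := by unfold c; positivity

lemma Lop_mono {s : ℝ} {S : Set ℝ} (hS : ∀ b, ∀ x ∈ S, ph b x ∈ S) (n : ℕ) :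
    ∀ {h k : ℝ → ℝ}, (∀ x ∈ S, h x ≤ k x) → ∀ x ∈ S, (Lop s ^ n) h x ≤ (Lop s ^ n) k x := by
  induction n with
  | zero => intro h k hk x hx; simpa using hk x hx
  | succ n ih =>
    intro h k hk x hx
    rw [pow_succ, Module.End.mul_apply, Module.End.mul_apply]
    refine ih (fun y hy => ?_) x hx
    rw [Lop_apply, Lop_apply]
    have h1 := hk _ (hS false y hy)
    have h2 := hk _ (hS true y hy)
    have h3 := Real.rpow_nonneg (c_nonneg false y) s
    have h4 := Real.rpow_nonneg (c_nonneg true y) s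
    gcongr

lemma I_inv : ∀ b, ∀ x ∈ Set.Icc (0:ℝ) 1, ph b x ∈ Set.Icc (0:ℝ) 1 := fun _ _ h => ph_mem h

/-- Total masses. -/
noncomputable def Z (s : ℝ) (n : ℕ) : ℝ := (Lop s ^ n) (fun _ => 1) 0

lemma Lop_const (s r : ℝ) (n : ℕ) : (Lop s ^ n) (fun _ => r) 0 = r * Z s n := by
  have : (fun _ : ℝ => r) = r • (fun _ : ℝ => (1:ℝ)) := by funext x; simp
  rw [this, map_smul]; rfl

lemma Z_zero (s : ℝ) : Z s 0 = 1 := by simp [Z]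

lemma Z_bound {s : ℝ} {g : ℝ → ℝ} (hg : ContinuousOn g (Set.Icc 0 1))
    (hgpos : ∀ x ∈ Set.Icc (0 : ℝ) 1, 0 < g x)
    (hgb : ∀ x ∈ Set.Icc (0 : ℝ) 1, g x ≤ Mt s g x) :
    ∃ C : ℝ, 0 < C ∧ ∀ n k, Z s n ≤ C * Z s (n + k) := by
  obtain ⟨x0, hx0, hmin⟩ := isCompact_Icc.exists_isMinOn ⟨0, zmem⟩ hg
  obtain ⟨x1, hx1, hmax⟩ := isCompact_Icc.exists_isMaxOn ⟨0, zmem⟩ hg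
  have hm := hgpos x0 hx0
  have hM := hgpos x1 hx1
  refine ⟨g x1 / g x0, by positivity, fun n k => ?_⟩
  have h1 : ∀ k : ℕ, ∀ x ∈ Set.Icc (0:ℝ) 1, g x ≤ (Lop s ^ k) g x := by
    intro k
    induction k with
    | zero => intro x _; simp
    | succ k ih =>
      intro x hx
      rw [pow_succ, Module.End.mul_apply]
      exact (ih x hx).trans (Lop_mono I_inv k hgb x hx)
  have h2 : ∀ x ∈ Set.Icc (0:ℝ) 1, g x0 ≤ (g x1 • (Lop s ^ k) (fun _ => 1)) x := by
    intro x hx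
    rw [← map_smul]
    refine ((hmin hx : g x0 ≤ g x).trans (h1 k x hx)).trans ?_
    refine Lop_mono I_inv k (fun y hy => ?_) x hx
    simpa using (hmax hy : g y ≤ g x1)
  have h3 := Lop_mono (s := s) I_inv n (h := fun _ => g x0) h2 0 zmem
  rw [Lop_const, map_smul, ← Module.End.mul_apply, ← pow_add] at h3
  simp only [Pi.smul_apply, smul_eq_mul] at h3
  change g x0 * Z s n ≤ g x1 * Z s (n + k) at h3
  rw [div_mul_eq_mul_div, le_div_iff₀ hm]
  linarith

lemma gap : (1/4 : ℝ) ≤ Real.sqrt 3 - Real.sqrt 2 := by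
  have h2 : Real.sqrt 2 ≤ 1.42 := by rw [Real.sqrt_le_iff]; norm_num
  have h3 : 1.73 ≤ Real.sqrt 3 := by apply Real.le_sqrt_of_sq_le; norm_num
  linarith

lemma both {w : List Bool} {u v ρ : ℝ} (hu : u ∈ Set.Icc (0:ℝ) 1) (hv : v ∈ Set.Icc (0:ℝ) 1)
    (h : |Ph w (ph true v) - Ph w (ph false u)| ≤ ρ) : D w 0 ≤ 4 * Real.exp 1 * ρ := by
  have h1 : ph false u ≤ Real.sqrt 2 - 1 := by
    unfold ph; gcongr; simp only [a]; norm_num; linarith [hu.2]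
  have h2 : Real.sqrt 3 - 1 ≤ ph true v := by
    unfold ph; gcongr; simp only [a]; norm_num; linarith [hv.1]
  have h3 := gap
  have h4 := Ph_lower (w := w) (ph_mem (b := false) hu).1 (y := ph true v) (by linarith)
    (ph_mem hv).2
  have h5 := Ph_mono w (show ph false u ≤ ph true v by linarith)
  have h6 : Real.exp (1 - (1/2) ^ w.length) ≤ Real.exp 1 := by
    apply Real.exp_le_exp.2
    have : (0:ℝ) < (1/2)^w.length := by positivity
    linarith
  have h7 := (le_abs_self _).trans h
  have h8 := D_pos (w := w) zmem
  have h9 : D w 0 * (1/4) ≤ D w 0 * (ph true v - ph false u) := by gcongr; linarith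
  have h10 : Real.exp (1 - (1/2) ^ w.length) * (Ph w (ph true v) - Ph w (ph false u))
      ≤ Real.exp 1 * ρ := by
    apply mul_le_mul h6 h7 (by linarith) (Real.exp_pos _).le
  linarith

lemma mass {s C : ℝ} (hs : 0 < s) (hC0 : 0 < C) (hC : ∀ n k, Z s n ≤ C * Z s (n + k))
    {U : Set ℝ} {ρ : ℝ} (hρ : 0 ≤ ρ) (hU : ∀ x ∈ U, ∀ y ∈ U, |x - y| ≤ ρ) (n : ℕ) :
    ∀ w : List Bool, (Lop s ^ n) (fun x => D w x ^ s * U.indicator 1 (Ph w x)) 0 ≤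
      ((4 * Real.exp 1 * ρ) ^ s + ((1/2 : ℝ) ^ (n + w.length)) ^ s) * (C * Z s (n + w.length)) := by
  have hZ : ∀ n, 0 < C * Z s n := fun n => by
    have := hC 0 n
    rw [Z_zero, zero_add] at this; linarith
  have hind : ∀ y, U.indicator (1 : ℝ → ℝ) y ≤ 1 := fun y =>
    Set.indicator_le_self' (fun _ _ => zero_le_one) y
  have hind0 : ∀ y, 0 ≤ U.indicator (1 : ℝ → ℝ) y := fun y =>
    Set.indicator_nonneg (fun _ _ => zero_le_one) y
  induction n with
  | zero =>
    intro w
    simp only [pow_zero, Module.End.one_apply, zero_add]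
    have h1 : D w 0 ^ s ≤ ((1/2 : ℝ) ^ w.length) ^ s :=
      Real.rpow_le_rpow (D_pos zmem).le (D_le zmem) hs.le
    have h2 : D w 0 ^ s * U.indicator 1 (Ph w 0) ≤ ((1/2 : ℝ) ^ w.length) ^ s := by
      have := mul_le_mul h1 (hind (Ph w 0)) (hind0 _) (by positivity)
      linarith
    have h3 := hC 0 w.length
    rw [Z_zero, zero_add] at h3
    have h4 : 0 ≤ (4 * Real.exp 1 * ρ) ^ s := by positivity
    have h5 : 0 ≤ ((1/2 : ℝ) ^ w.length) ^ s := by positivity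
    nlinarith
  | succ n ih =>
    intro w
    by_cases hb : (∃ u ∈ Set.Icc (0:ℝ) 1, Ph w (ph false u) ∈ U) ∧
        (∃ v ∈ Set.Icc (0:ℝ) 1, Ph w (ph true v) ∈ U)
    · obtain ⟨⟨u, hu, hu'⟩, ⟨v, hv, hv'⟩⟩ := hb
      have hD := both hu hv (hU _ hv' _ hu')
      have h1 : (Lop s ^ (n+1)) (fun x => D w x ^ s * U.indicator 1 (Ph w x)) 0 ≤
          (Lop s ^ (n+1)) (fun _ => (4 * Real.exp 1 * ρ) ^ s) 0 := by
        refine Lop_mono I_inv _ (fun x hx => ?_) 0 zmem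
        have h2 : D w x ^ s ≤ (4 * Real.exp 1 * ρ) ^ s :=
          Real.rpow_le_rpow (D_pos hx).le ((D_le_zero hx).trans hD) hs.le
        have := mul_le_mul h2 (hind (Ph w x)) (hind0 _) (by positivity)
        linarith
      rw [Lop_const] at h1
      refine h1.trans ?_
      have h4 : 0 ≤ (4 * Real.exp 1 * ρ) ^ s := by positivity
      have h5 : 0 ≤ ((1/2 : ℝ) ^ (n + 1 + w.length)) ^ s := by positivity
      exact (mul_le_mul_of_nonneg_left (hC (n + 1) w.length) h4).trans
        (mul_le_mul_of_nonneg_right (by linarith) (hZ _).le)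
    · have hstep : ∀ b : Bool, (∀ x ∈ Set.Icc (0:ℝ) 1,
          Lop s (fun x => D w x ^ s * U.indicator 1 (Ph w x)) x ≤
            D (w ++ [b]) x ^ s * U.indicator 1 (Ph (w ++ [b]) x)) →
          (Lop s ^ (n+1)) (fun x => D w x ^ s * U.indicator 1 (Ph w x)) 0 ≤
      ((4 * Real.exp 1 * ρ) ^ s + ((1/2 : ℝ) ^ (n + 1 + w.length)) ^ s) *
        (C * Z s (n + 1 + w.length)) := by
        intro b hb
        rw [pow_succ, Module.End.mul_apply]
        refine (Lop_mono I_inv n hb 0 zmem).trans ?_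
        have := ih (w ++ [b])
        have e : n + (w ++ [b]).length = n + 1 + w.length := by simp; omega
        rwa [e] at this
      have hmul : ∀ b, ∀ x ∈ Set.Icc (0:ℝ) 1, D (w ++ [b]) x ^ s = c b x ^ s * D w (ph b x) ^ s := by
        intro b x hx
        rw [D_snoc, Real.mul_rpow (c_nonneg _ _) (D_pos (ph_mem hx)).le]
      rcases not_and_or.1 hb with hb | hb
      · apply hstep true
        intro x hx
        have : Ph w (ph false x) ∉ U := fun h => hb ⟨x, hx, h⟩
        rw [Lop_apply, hmul _ _ hx, Ph_snoc, Set.indicator_of_notMem this]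
        apply le_of_eq; ring
      · apply hstep false
        intro x hx
        have : Ph w (ph true x) ∉ U := fun h => hb ⟨x, hx, h⟩
        rw [Lop_apply, hmul _ _ hx, Ph_snoc, Set.indicator_of_notMem this]
        apply le_of_eq; ring

lemma finite_cover {s C : ℝ} (hs : 0 < s) (hC0 : 0 < C) (hC : ∀ n k, Z s n ≤ C * Z s (n + k))
    {U : ℕ → Set ℝ} {ρ : ℕ → ℝ} (hρ : ∀ i, 0 ≤ ρ i)
    (hU : ∀ i, ∀ x ∈ U i, ∀ y ∈ U i, |x - y| ≤ ρ i) (F : Finset ℕ)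
    (hF : closure E ⊆ ⋃ i ∈ F, U i) :
    1 ≤ C * (4 * Real.exp 1) ^ s * ∑ i ∈ F, ρ i ^ s := by
  have hN : ∀ N : ℕ, 1 ≤ C * ∑ i ∈ F, ((4 * Real.exp 1 * ρ i) ^ s + ((1/2 : ℝ) ^ N) ^ s) := by
    intro N
    have hZ : 0 < Z s N := by
      have := hC 0 N
      rw [Z_zero, zero_add] at this
      by_contra h
      nlinarith
    have h1 : Z s N ≤ (Lop s ^ N) (∑ i ∈ F, (U i).indicator 1) 0 := by
      refine Lop_mono (S := closure E) (fun b x hx => K_ph hx) N (fun x hx => ?_) 0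
        (subset_closure zero_mem_E)
      obtain ⟨i, hi, hx'⟩ := Set.mem_iUnion₂.1 (hF hx)
      rw [Finset.sum_apply]
      have h2 : (1:ℝ) = (U i).indicator 1 x := by rw [Set.indicator_of_mem hx']; rfl
      rw [h2]
      exact Finset.single_le_sum (f := fun i => (U i).indicator (1 : ℝ → ℝ) x)
        (fun j _ => Set.indicator_nonneg (fun _ _ => zero_le_one) x) hi
    rw [map_sum, Finset.sum_apply] at h1
    have h3 : ∑ i ∈ F, (Lop s ^ N) ((U i).indicator 1) 0 ≤
        ∑ i ∈ F, ((4 * Real.exp 1 * ρ i) ^ s + ((1/2 : ℝ) ^ N) ^ s) * (C * Z s N) := by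
      apply Finset.sum_le_sum
      intro i _
      have := mass hs hC0 hC (hρ i) (hU i) N []
      simpa [D, Ph] using this
    rw [← Finset.sum_mul] at h3
    have h4 := h1.trans h3
    by_contra h
    push Not at h
    nlinarith
  have hlim : Tendsto (fun N : ℕ => C * ∑ i ∈ F, ((4 * Real.exp 1 * ρ i) ^ s + ((1/2 : ℝ) ^ N) ^ s))
      atTop (nhds (C * ∑ i ∈ F, ((4 * Real.exp 1 * ρ i) ^ s + (0:ℝ) ^ s))) := by
    have h0 : Tendsto (fun N : ℕ => ((1/2 : ℝ) ^ N) ^ s) atTop (nhds ((0:ℝ) ^ s)) :=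
      (tendsto_pow_atTop_nhds_zero_of_lt_one (by norm_num) (by norm_num)).rpow_const
        (Or.inr hs.le)
    exact (tendsto_finsetSum _ fun i _ => h0.const_add _).const_mul C
  have h := ge_of_tendsto' hlim hN
  refine h.trans (le_of_eq ?_)
  rw [Real.zero_rpow hs.ne', mul_assoc, Finset.mul_sum F _ ((4 * Real.exp 1) ^ s)]
  congr 1
  apply Finset.sum_congr rfl
  intro i _
  rw [add_zero, Real.mul_rpow (by positivity) (hρ i)]

lemma lower_measure {s C : ℝ} (hs : 0 < s) (hC0 : 0 < C)
    (hC : ∀ n k, Z s n ≤ C * Z s (n + k)) :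
    ENNReal.ofReal (1 / (C * (4 * Real.exp 1) ^ s)) ≤
      MeasureTheory.Measure.hausdorffMeasure s (closure E) := by
  rw [MeasureTheory.Measure.hausdorffMeasure_apply]
  refine le_iSup₂_of_le 1 one_pos (le_iInf fun t => le_iInf fun hcov => le_iInf fun hd => ?_)
  have hbdd : ∀ i, Bornology.IsBounded (t i) := fun i =>
    Metric.isBounded_iff_ediam_ne_top.2 ((hd i).trans_lt ENNReal.one_lt_top).ne
  apply ENNReal.le_of_forall_pos_le_add
  intro ε hε _
  obtain ⟨ε', hε', hsum⟩ := ENNReal.exists_pos_sum_of_countable (ε := (ε : ENNReal))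
    (by simpa using hε.ne') ℕ
  have hδ : ∀ i, ∃ δ > 0, (Metric.diam (t i) + 2 * δ) ^ s ≤ Metric.diam (t i) ^ s + ε' i := by
    intro i
    have hc : Tendsto (fun δ : ℝ => (Metric.diam (t i) + 2 * δ) ^ s) (nhds 0)
        (nhds ((Metric.diam (t i) + 2 * 0) ^ s)) :=
      ((tendsto_id.const_mul 2).const_add _).rpow_const (Or.inr hs.le)
    rw [mul_zero, add_zero] at hc
    have h1 := hc.eventually (eventually_le_nhds (show Metric.diam (t i) ^ s <
      Metric.diam (t i) ^ s + ε' i from lt_add_of_pos_right _ (by exact_mod_cast hε' i)))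
    obtain ⟨δ, h2, h3⟩ := ((h1.filter_mono nhdsWithin_le_nhds).and
      (self_mem_nhdsWithin (s := Set.Ioi (0:ℝ)))).exists
    exact ⟨δ, h3, h2⟩
  choose δ hδ0 hδ using hδ
  obtain ⟨F, hF⟩ := K_compact.elim_finite_subcover (fun i => Metric.thickening (δ i) (t i))
    (fun i => Metric.isOpen_thickening)
    (hcov.trans (Set.iUnion_mono fun i => Metric.self_subset_thickening (hδ0 i) _))
  have h1 := finite_cover hs hC0 hC (U := fun i => Metric.thickening (δ i) (t i))
    (ρ := fun i => Metric.diam (t i) + 2 * δ i)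
    (fun i => add_nonneg Metric.diam_nonneg (by linarith [hδ0 i])) (by
      intro i x hx y hy
      obtain ⟨x', hx', hx⟩ := Metric.mem_thickening_iff.1 hx
      obtain ⟨y', hy', hy⟩ := Metric.mem_thickening_iff.1 hy
      have h2 := Metric.dist_le_diam_of_mem (hbdd i) hx' hy'
      have h3 := dist_triangle4 x x' y' y
      rw [dist_comm y' y] at h3
      rw [← Real.dist_eq]
      linarith) F hF
  have hB : 0 < C * (4 * Real.exp 1) ^ s := by positivity
  have h2 : 1 / (C * (4 * Real.exp 1) ^ s) ≤ ∑ i ∈ F, (Metric.diam (t i) ^ s + ε' i) := by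
    rw [div_le_iff₀ hB, mul_comm]
    refine h1.trans ?_
    gcongr with i _
    exact hδ i
  calc ENNReal.ofReal (1 / (C * (4 * Real.exp 1) ^ s))
      ≤ ENNReal.ofReal (∑ i ∈ F, (Metric.diam (t i) ^ s + ε' i)) := ENNReal.ofReal_le_ofReal h2
    _ = ∑ i ∈ F, (Metric.ediam (t i) ^ s + ε' i) := by
        rw [ENNReal.ofReal_sum_of_nonneg (fun i _ => by positivity)]
        apply Finset.sum_congr rfl
        intro i _
        rw [ENNReal.ofReal_add (by positivity) (by positivity), ENNReal.ofReal_coe_nnreal,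
          ← ENNReal.ofReal_rpow_of_nonneg Metric.diam_nonneg hs.le, Metric.diam,
          ENNReal.ofReal_toReal (hbdd i).ediam_ne_top]
    _ = ∑ i ∈ F, Metric.ediam (t i) ^ s + ∑ i ∈ F, (ε' i : ENNReal) := Finset.sum_add_distrib
    _ ≤ (∑' i, ⨆ _ : (t i).Nonempty, Metric.ediam (t i) ^ s) + ε := by
        refine add_le_add ?_ ((ENNReal.sum_le_tsum F).trans hsum.le)
        refine le_trans ?_ (ENNReal.sum_le_tsum F)
        apply Finset.sum_le_sum
        intro i _
        by_cases hne : (t i).Nonempty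
        · exact le_iSup_of_le hne le_rfl
        · rw [Set.not_nonempty_iff_eq_empty.1 hne]
          simp [hs]

lemma lower {s : ℝ} (hs : 0 < s) {g : ℝ → ℝ} (hg : ContinuousOn g (Set.Icc 0 1))
    (hgpos : ∀ x ∈ Set.Icc (0 : ℝ) 1, 0 < g x)
    (hgb : ∀ x ∈ Set.Icc (0 : ℝ) 1, g x ≤ Mt s g x) : ENNReal.ofReal s ≤ dimH E := by
  obtain ⟨C, hC0, hC⟩ := Z_bound hg hgpos hgb
  have h := lower_measure hs hC0 hC
  refine le_trans ?_ dimH_K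
  refine le_dimH_of_hausdorffMeasure_ne_zero (s := closure E) (d := s.toNNReal) ?_
  rw [Real.coe_toNNReal _ hs.le]
  refine (lt_of_lt_of_le ?_ h).ne'
  rw [ENNReal.ofReal_pos]
  positivity

lemma four_le : (4:ℝ) ≤ Real.exp 2 := by
  have h := Real.add_one_le_exp (1:ℝ)
  have : Real.exp 2 = Real.exp 1 * Real.exp 1 := by rw [← Real.exp_add]; norm_num
  rw [this]; nlinarith

lemma c_shift {b : Bool} {x : ℝ} (hx : x ∈ Set.Icc (0:ℝ) 1) (s : ℝ) {ε : ℝ} (hε : 0 ≤ ε) :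
    c b x ^ s ≤ Real.exp (2 * ε) * c b x ^ (s + ε) := by
  have hc := c_pos (b := b) hx.1
  rw [Real.rpow_add hc]
  have h1 : (Real.exp (-2)) ^ ε ≤ c b x ^ ε := by
    apply Real.rpow_le_rpow (Real.exp_pos _).le _ hε
    refine le_trans ?_ (c_ge hx)
    rw [Real.exp_neg, one_div]
    exact inv_anti₀ (by norm_num) four_le
  rw [← Real.exp_mul] at h1
  have h2 : 1 ≤ Real.exp (2 * ε) * c b x ^ ε := by
    calc 1 = Real.exp (2 * ε) * Real.exp (-2 * ε) := by rw [← Real.exp_add]; simp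
      _ ≤ _ := by gcongr
  have h3 : 0 ≤ c b x ^ s := Real.rpow_nonneg hc.le s
  nlinarith

lemma Mt_shift {x : ℝ} (hx : x ∈ Set.Icc (0:ℝ) 1) (s : ℝ) {ε : ℝ} (hε : 0 ≤ ε) {h : ℝ → ℝ}
    (hh : ∀ x ∈ Set.Icc (0:ℝ) 1, 0 < h x) :
    Mt s h x ≤ Real.exp (2 * ε) * Mt (s + ε) h x := by
  rw [Mt_eq, Mt_eq]
  have h1 := mul_le_mul_of_nonneg_right (c_shift (b := false) hx s hε)
    (hh _ (ph_mem (b := false) hx)).le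
  have h2 := mul_le_mul_of_nonneg_right (c_shift (b := true) hx s hε)
    (hh _ (ph_mem (b := true) hx)).le
  linarith

end BR

theorem dimension_bounds (t₀ t₁ α β : ℝ) (ht₀ : 0 < t₀) (ht : t₀ < t₁)
    (hα : 0 < α) (hβ : 0 < β) (g f : ℝ → ℝ)
    (hg : ContinuousOn g (Set.Icc 0 1)) (hf : ContinuousOn f (Set.Icc 0 1))
    (hgpos : ∀ x ∈ Set.Icc (0 : ℝ) 1, 0 < g x)
    (hfpos : ∀ x ∈ Set.Icc (0 : ℝ) 1, 0 < f x)
    (hgbound : ∀ x ∈ Set.Icc (0 : ℝ) 1, Real.exp β * g x ≤ Mt t₀ g x)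
    (hfbound : ∀ x ∈ Set.Icc (0 : ℝ) 1, Mt t₁ f x ≤ Real.exp (-α) * f x) :
    ENNReal.ofReal t₀ < dimH E ∧ dimH E < ENNReal.ofReal t₁ := by
  constructor
  · have h := BR.lower (s := t₀ + β / 2) (by positivity) hg hgpos (fun x hx => by
      have h1 := hgbound x hx
      have h2 := BR.Mt_shift hx t₀ (ε := β / 2) (by positivity) hgpos
      rw [mul_div_cancel₀ β two_ne_zero] at h2
      exact le_of_mul_le_mul_left (h1.trans h2) (Real.exp_pos β))
    refine lt_of_lt_of_le ?_ h
    rw [ENNReal.ofReal_lt_ofReal_iff (by positivity)]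
    linarith
  · have ht₁ : 0 < t₁ := ht₀.trans ht
    obtain ⟨ε, hε, hε1, hε2⟩ : ∃ ε : ℝ, 0 < ε ∧ ε < t₁ ∧ 2 * ε ≤ α :=
      ⟨min (t₁ / 2) (α / 2), by positivity, by linarith [min_le_left (t₁ / 2) (α / 2)],
        by linarith [min_le_right (t₁ / 2) (α / 2)]⟩
    have h := BR.upper (s := t₁ - ε) (by linarith) hf hfpos (fun x hx => by
      have h1 := hfbound x hx
      have h2 := BR.Mt_shift hx (t₁ - ε) hε.le hfpos
      rw [sub_add_cancel] at h2
      refine h2.trans ((mul_le_mul_of_nonneg_left h1 (Real.exp_pos _).le).trans ?_)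
      rw [← mul_assoc, ← Real.exp_add]
      have h3 : Real.exp (2 * ε + -α) ≤ 1 := by rw [Real.exp_le_one_iff]; linarith
      have h4 := hfpos x hx
      nlinarith)
    refine lt_of_le_of_lt h ?_
    rw [ENNReal.ofReal_lt_ofReal_iff ht₁]
    linarith
end
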